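/- For every integer n > 3 and every ε ∈ (0,1), there exists μ_n* > 0 such that for every μ with 0 < μ < μ_n* there exist at least two distinct solutions x ∈ (0,1) of the equation h(x, ε) = μ. -/

import Mathlib

/-- `k_n = (1/(4n)) · Σ_{k=1}^{n-1} 1/sin(kπ/n)` -/
noncomputable def kn (n : ℕ) : ℝ :=
  (1 / (4 * n)) * ∑ k ∈ Finset.Icc 1 (n - 1), 1 / Real.sin (k * Real.pi / n)

/-- `φ_k = (2k-1)π/n`, and `u_k = cos φ_k`. -/
noncomputable def phi (n k : ℕ) : ℝ := (2 * (k : ℝ) - 1) * Real.pi / n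

/-- The reduced central configuration function
`h(x, ε) = −n·k_n·(ε−x³)/(1−x³) − (x²/(1−x³))·Σ_{k=1}^{n} [x(1−ε) − (1−εx²)u_k]/(1+x²−2xu_k)^{3/2}`,
where `u_k = cos φ_k`.  Solutions of `h(x, ε) = μ` are the rosette central configurations. -/
noncomputable def h (n : ℕ) (x ε : ℝ) : ℝ :=
  -((n : ℝ) * kn n) * (ε - x ^ 3) / (1 - x ^ 3) -
    (x ^ 2 / (1 - x ^ 3)) * ∑ k ∈ Finset.Icc 1 n,
      (x * (1 - ε) - (1 - ε * x ^ 2) * Real.cos (phi n k)) /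
        (1 + x ^ 2 - 2 * x * Real.cos (phi n k)) ^ ((3 : ℝ) / 2)

open Finset in
/-- A finite sum over `1..n` whose terms are at most `M`, and at most `a` at both ends. -/
lemma sum_Icc_le_of_ends {n : ℕ} (hn : 2 ≤ n) {f : ℕ → ℝ} {a M : ℝ} (h1 : f 1 ≤ a) (h2 : f n ≤ a)
    (hM : ∀ k ∈ Icc 1 n, f k ≤ M) : ∑ k ∈ Icc 1 n, f k ≤ 2 * a + (n - 2) * M := by
  have hsub : ({1, n} : Finset ℕ) ⊆ Icc 1 n := by
    intro k hk
    simp only [mem_insert, mem_singleton] at hk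
    rw [mem_Icc]
    omega
  have key : ∑ k ∈ ({1, n} : Finset ℕ), (M - f k) ≤ ∑ k ∈ Icc 1 n, (M - f k) :=
    sum_le_sum_of_subset_of_nonneg hsub fun k hk _ => sub_nonneg.2 (hM k hk)
  rw [sum_pair (by omega), sum_sub_distrib, sum_const, Nat.card_Icc, nsmul_eq_mul] at key
  simp only [Nat.add_sub_cancel] at key
  linarith

lemma sub_mul_cube_le {b M t : ℝ} (ht : 0 ≤ t) (hM : 0 < M) (hbM : 4 ≤ 27 * b * M ^ 2) :
    t - b * t ^ 3 ≤ M := by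
  have h1 : 0 ≤ (2 * t - 3 * M) ^ 2 * (t + 3 * M) := by positivity
  have h2 : 0 ≤ t ^ 3 * (27 * b * M ^ 2 - 4) := mul_nonneg (by positivity) (by linarith)
  have h3 : 0 ≤ 27 * M ^ 2 * (M - (t - b * t ^ 3)) := by nlinarith
  have h4 : 0 < 27 * M ^ 2 := by positivity
  linarith [nonneg_of_mul_nonneg_right h3 h4]

lemma sub_mul_cube_anti {b s t : ℝ} (hs : 0 ≤ s) (hst : s ≤ t) (hb : 1 ≤ 3 * b * s ^ 2) :
    t - b * t ^ 3 ≤ s - b * s ^ 3 := by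
  have hb0 : 0 < b := by
    by_contra! hneg
    nlinarith [sq_nonneg s]
  have h1 : 3 * s ^ 2 ≤ t ^ 2 + t * s + s ^ 2 := by nlinarith
  have h2 : b * (3 * s ^ 2) ≤ b * (t ^ 2 + t * s + s ^ 2) := by gcongr
  nlinarith [mul_nonneg (sub_nonneg.2 hst) (by linarith : 0 ≤ b * (t ^ 2 + t * s + s ^ 2) - 1)]

lemma inv_sin_le_midpoint {a b : ℝ} (h1 : 0 < Real.sin (a - b)) (h2 : 0 < Real.sin (a + b))
    (ha : 0 < Real.sin a) :
    1 / Real.sin a ≤ (1 / Real.sin (a - b) + 1 / Real.sin (a + b)) / 2 := by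
  have hsum : Real.sin (a - b) + Real.sin (a + b) ≤ 2 * Real.sin a := by
    rw [Real.sin_sub, Real.sin_add]
    nlinarith [Real.cos_le_one b]
  have h3 : 2 / Real.sin a ≤ 4 / (Real.sin (a - b) + Real.sin (a + b)) := by
    rw [div_le_div_iff₀ ha (by positivity)]
    linarith
  have h4 : 4 / (Real.sin (a - b) + Real.sin (a + b)) ≤
      1 / Real.sin (a - b) + 1 / Real.sin (a + b) := by
    rw [div_add_div _ _ h1.ne' h2.ne', div_le_div_iff₀ (by positivity) (by positivity)]
    nlinarith [sq_nonneg (Real.sin (a - b) - Real.sin (a + b))]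
  have h5 : 2 / Real.sin a = 2 * (1 / Real.sin a) := by ring
  linarith

lemma sin_mul_pi_div_pos {n : ℕ} {r : ℝ} (h0 : 0 < r) (h1 : r < n) :
    0 < Real.sin (r * Real.pi / n) := by
  have hn : (0 : ℝ) < n := h0.trans h1
  apply Real.sin_pos_of_pos_of_lt_pi
  · positivity
  · rw [div_lt_iff₀ hn]
    nlinarith [Real.pi_pos]

lemma mul_kn {n : ℕ} (hn : 0 < n) :
    n * kn n = (1 / 4) * ∑ k ∈ Finset.Icc 1 (n - 1), 1 / Real.sin (k * Real.pi / n) := by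
  have : (n : ℝ) ≠ 0 := by positivity
  rw [kn, ← mul_assoc]
  congr 1
  field_simp

/-- The reciprocal sines at odd multiples of `π/(2n)` sum to more than those at even multiples. -/
lemma sum_inv_sin_lt (n : ℕ) (hn : 0 < n) :
    ∑ k ∈ Finset.Icc 1 (n - 1), 1 / Real.sin (k * Real.pi / n) <
      ∑ k ∈ Finset.Icc 1 n, 1 / Real.sin (phi n k / 2) := by
  obtain ⟨m, rfl⟩ : ∃ m, n = m + 1 := ⟨n - 1, by omega⟩
  set g : ℕ → ℝ := fun k => 1 / Real.sin (phi (m + 1) k / 2) with hg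
  have hphi : ∀ k : ℕ, phi (m + 1) k / 2 = (k - 1 / 2 : ℝ) * Real.pi / (m + 1 : ℕ) := by
    intro k
    rw [phi]
    ring
  have hgpos : ∀ k : ℕ, 1 ≤ k → k ≤ m + 1 → 0 < g k := by
    intro k h1 h2
    have h1' : (1 : ℝ) ≤ k := by exact_mod_cast h1
    have h2' : (k : ℝ) ≤ (m + 1 : ℕ) := by exact_mod_cast h2
    simp only [hg, hphi]
    exact one_div_pos.2 (sin_mul_pi_div_pos (by linarith) (by linarith))
  have hmid : ∀ k ∈ Finset.Icc 1 m,
      1 / Real.sin (k * Real.pi / (m + 1 : ℕ)) ≤ (g k + g (k + 1)) / 2 := by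
    intro k hk
    rw [Finset.mem_Icc] at hk
    have h1 : (1 : ℝ) ≤ k := by exact_mod_cast hk.1
    have h2 : (k : ℝ) + 1 ≤ (m + 1 : ℕ) := by exact_mod_cast Nat.succ_le_succ hk.2
    have e1 : phi (m + 1) k / 2 = k * Real.pi / (m + 1 : ℕ) - Real.pi / (2 * (m + 1 : ℕ)) := by
      rw [hphi]
      field_simp
    have e2 : phi (m + 1) (k + 1) / 2 =
        k * Real.pi / (m + 1 : ℕ) + Real.pi / (2 * (m + 1 : ℕ)) := by
      rw [hphi]
      field_simp
      push_cast
      ring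
    have p1 := one_div_pos.1 (hgpos k hk.1 (by omega))
    have p2 := one_div_pos.1 (hgpos (k + 1) (by omega) (by omega))
    simp only [hg]
    rw [e1] at p1 ⊢
    rw [e2] at p2 ⊢
    exact inv_sin_le_midpoint p1 p2 (sin_mul_pi_div_pos (by linarith) (by linarith))
  have htel : ∀ j : ℕ, ∑ k ∈ Finset.Icc 1 j, (g k + g (k + 1)) / 2 =
      ∑ k ∈ Finset.Icc 1 (j + 1), g k - (g 1 + g (j + 1)) / 2 := by
    intro j
    induction j with
    | zero => simp
    | succ j ih =>
      rw [Finset.sum_Icc_succ_top (by omega), ih, Finset.sum_Icc_succ_top (b := j + 1) (by omega)]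
      ring
  have h1 := Finset.sum_le_sum hmid
  rw [htel m] at h1
  have h2 := hgpos 1 le_rfl (by omega)
  have h3 := hgpos (m + 1) (by omega) le_rfl
  simp only [Nat.add_sub_cancel]
  linarith

lemma le_mul_kn {n : ℕ} (hn : 0 < n) : ((n : ℝ) - 1) / 4 ≤ n * kn n := by
  have h1 : ∑ k ∈ Finset.Icc 1 (n - 1), (1 : ℝ) ≤
      ∑ k ∈ Finset.Icc 1 (n - 1), 1 / Real.sin (k * Real.pi / n) := by
    refine Finset.sum_le_sum fun k hk => ?_
    rw [Finset.mem_Icc] at hk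
    have h1 : (1 : ℝ) ≤ k := by exact_mod_cast hk.1
    have h2 : (k : ℝ) < n := by exact_mod_cast (by omega : k < n)
    rw [le_div_iff₀ (sin_mul_pi_div_pos (by linarith) h2), one_mul]
    exact Real.sin_le_one _
  rw [mul_kn hn]
  simp only [Finset.sum_const, Nat.card_Icc, Nat.add_sub_cancel, nsmul_eq_mul, mul_one] at h1
  rw [Nat.cast_sub hn, Nat.cast_one] at h1
  linarith

lemma two_sqrt_two_div_le_sin {n : ℕ} (hn : 4 ≤ n) :
    2 * √2 / n ≤ Real.sin (Real.pi / n) := by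
  have hn' : (4 : ℝ) ≤ n := by exact_mod_cast hn
  have hc := strictConcaveOn_sin_Icc.concaveOn.2
    (⟨le_rfl, Real.pi_pos.le⟩ : (0 : ℝ) ∈ Set.Icc 0 Real.pi)
    (⟨by positivity, by linarith [Real.pi_pos]⟩ : Real.pi / 4 ∈ Set.Icc 0 Real.pi)
    (sub_nonneg.2 ((div_le_one (by linarith)).2 hn') : (0 : ℝ) ≤ 1 - 4 / n)
    (by positivity : (0 : ℝ) ≤ 4 / n) (by ring)
  simp only [smul_eq_mul, Real.sin_zero, mul_zero, zero_add, Real.sin_pi_div_four] at hc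
  have e1 : 4 / (n : ℝ) * (Real.pi / 4) = Real.pi / n := by ring
  have e2 : 4 / (n : ℝ) * (√2 / 2) = 2 * √2 / n := by ring
  rwa [e1, e2] at hc

lemma sin_pi_div_le {n k : ℕ} (h1 : 1 ≤ k) (h2 : k + 1 ≤ n) :
    Real.sin (Real.pi / n) ≤ Real.sin (k * Real.pi / n) := by
  have h1' : (1 : ℝ) ≤ k := by exact_mod_cast h1
  have h2' : (k : ℝ) + 1 ≤ n := by exact_mod_cast h2
  have hn : (0 : ℝ) < n := by linarith
  have hp := Real.pi_pos
  have hle : Real.pi / n ≤ k * Real.pi / n := by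
    gcongr
    nlinarith
  have hle' : k * Real.pi / n ≤ Real.pi - Real.pi / n := by
    rw [le_sub_iff_add_le, ← add_div, div_le_iff₀ hn]
    nlinarith
  have hpos : 0 < Real.pi / n := by positivity
  have hc := strictConcaveOn_sin_Icc.concaveOn.min_le_of_mem_Icc
    (⟨hpos.le, by linarith⟩ : Real.pi / n ∈ Set.Icc 0 Real.pi)
    (⟨by linarith, by linarith⟩ : Real.pi - Real.pi / n ∈ Set.Icc 0 Real.pi) ⟨hle, hle'⟩
  simpa [Real.sin_pi_sub] using hc

lemma mul_kn_le {n : ℕ} (hn : 4 ≤ n) : n * kn n ≤ n * (n - 1) / 11.3 := by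
  have hn' : (4 : ℝ) ≤ n := by exact_mod_cast hn
  have hs2 : (1.4125 : ℝ) ≤ √2 := Real.le_sqrt_of_sq_le (by norm_num)
  have h1 : ∑ k ∈ Finset.Icc 1 (n - 1), 1 / Real.sin (k * Real.pi / n) ≤
      ∑ k ∈ Finset.Icc 1 (n - 1), (n : ℝ) / 2.825 := by
    refine Finset.sum_le_sum fun k hk => ?_
    rw [Finset.mem_Icc] at hk
    have hs : 2.825 / (n : ℝ) ≤ Real.sin (k * Real.pi / n) :=
      calc 2.825 / (n : ℝ) ≤ 2 * √2 / n := by gcongr; linarith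
        _ ≤ Real.sin (Real.pi / n) := two_sqrt_two_div_le_sin hn
        _ ≤ _ := sin_pi_div_le hk.1 (by omega)
    calc 1 / Real.sin (k * Real.pi / n) ≤ 1 / (2.825 / (n : ℝ)) :=
          one_div_le_one_div_of_le (by positivity) hs
      _ = _ := one_div_div _ _
  simp only [Finset.sum_const, Nat.card_Icc, Nat.add_sub_cancel, nsmul_eq_mul] at h1
  rw [Nat.cast_sub (by omega), Nat.cast_one] at h1
  have e : (n : ℝ) * (n - 1) / 11.3 = (1 / 4) * ((n - 1) * (n / 2.825)) := by ring
  rw [mul_kn (by omega), e]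
  gcongr

/-- The squared distance `1 + x² - 2xu_k`. -/
noncomputable def sqDist (n k : ℕ) (x : ℝ) : ℝ := 1 + x ^ 2 - 2 * x * Real.cos (phi n k)

/-- The numerator of `-h`. -/
noncomputable def numer (n : ℕ) (x ε : ℝ) : ℝ :=
  n * kn n * (ε - x ^ 3) + x ^ 2 * ∑ k ∈ Finset.Icc 1 n,
    (x * (1 - ε) - (1 - ε * x ^ 2) * Real.cos (phi n k)) / sqDist n k x ^ ((3 : ℝ) / 2)

lemma h_eq (n : ℕ) (x ε : ℝ) : h n x ε = -numer n x ε / (1 - x ^ 3) := by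
  simp only [h, numer, sqDist]
  ring

lemma sin_phi_half_pos {n k : ℕ} (hk : k ∈ Finset.Icc 1 n) : 0 < Real.sin (phi n k / 2) := by
  rw [Finset.mem_Icc] at hk
  have h1 : (1 : ℝ) ≤ k := by exact_mod_cast hk.1
  have h2 : (k : ℝ) ≤ n := by exact_mod_cast hk.2
  have e : phi n k / 2 = (k - 1 / 2 : ℝ) * Real.pi / n := by
    rw [phi]
    ring
  rw [e]
  exact sin_mul_pi_div_pos (by linarith) (by linarith)

lemma sqDist_eq (n k : ℕ) (x : ℝ) :
    sqDist n k x = (1 - x) ^ 2 + x * (2 * Real.sin (phi n k / 2)) ^ 2 := by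
  have h1 : Real.cos (phi n k) = 1 - 2 * Real.sin (phi n k / 2) ^ 2 := by
    have h2 := Real.cos_two_mul (phi n k / 2)
    rw [Real.cos_sq', mul_div_cancel₀ _ two_ne_zero] at h2
    linarith
  rw [sqDist, h1]
  ring

lemma sqDist_pos {n k : ℕ} (hk : k ∈ Finset.Icc 1 n) {x : ℝ} (hx : 0 ≤ x) :
    0 < sqDist n k x := by
  have hs := sin_phi_half_pos hk
  rw [sqDist_eq]
  rcases hx.eq_or_lt with rfl | hx
  · norm_num
  · positivity

lemma rpow_three_halves {d : ℝ} (hd : 0 < d) : d ^ ((3 : ℝ) / 2) = √d ^ 3 := by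
  rw [Real.sqrt_eq_rpow, ← Real.rpow_natCast, ← Real.rpow_mul hd.le]
  norm_num

lemma continuousOn_numer (n : ℕ) (ε : ℝ) :
    ContinuousOn (fun x => numer n x ε) (Set.Ici 0) := by
  unfold numer
  refine ContinuousOn.add (by fun_prop) (ContinuousOn.mul (by fun_prop) ?_)
  refine continuousOn_finsetSum _ fun k hk => ?_
  refine ContinuousOn.div (by fun_prop) ?_ fun x hx =>
    (Real.rpow_pos_of_pos (sqDist_pos hk hx) _).ne'
  refine ContinuousOn.rpow_const ?_ fun x hx => Or.inl (sqDist_pos hk hx).ne'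
  unfold sqDist
  fun_prop

lemma numer_one_pos {n : ℕ} (hn : 0 < n) {ε : ℝ} (hε : ε < 1) : 0 < numer n 1 ε := by
  have hterm : ∀ k ∈ Finset.Icc 1 n,
      (1 * (1 - ε) - (1 - ε * 1 ^ 2) * Real.cos (phi n k)) / sqDist n k 1 ^ ((3 : ℝ) / 2) =
        (1 - ε) * (1 / 4) * (1 / Real.sin (phi n k / 2)) := by
    intro k hk
    have hs := sin_phi_half_pos hk
    have hcos : Real.cos (phi n k) = 1 - 2 * Real.sin (phi n k / 2) ^ 2 := by
      have h2 := sqDist_eq n k 1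
      rw [sqDist] at h2
      linarith
    have hd : √(sqDist n k 1) = 2 * Real.sin (phi n k / 2) := by
      rw [sqDist_eq, Real.sqrt_eq_iff_mul_self_eq (by positivity) (by positivity)]
      ring
    rw [rpow_three_halves (sqDist_pos hk zero_le_one), hd, hcos]
    field_simp
    ring
  rw [numer, Finset.sum_congr rfl hterm, ← Finset.mul_sum, mul_kn hn]
  nlinarith [mul_pos (sub_pos.2 hε) (sub_pos.2 (sum_inv_sin_lt n hn))]

lemma numer_zero_pos {n : ℕ} (hn : 2 ≤ n) {ε : ℝ} (hε : 0 < ε) : 0 < numer n 0 ε := by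
  have hn' : (2 : ℝ) ≤ n := by exact_mod_cast hn
  have h1 := le_mul_kn (n := n) (by omega)
  have h2 : 0 < n * kn n := by linarith
  simp only [numer]
  norm_num
  exact mul_pos h2 hε

/-- A sufficient condition for negativity of the numerator, in terms of a lower bound `s` on the
reciprocal distance to the closest vertices and a bound `M` for the remaining contributions. -/
lemma numer_neg_of_bounds {n : ℕ} (hn : 4 ≤ n) {ε x s M : ℝ} (hε : ε ∈ Set.Ioo (0 : ℝ) 1)
    (hx0 : 0.6 ≤ x) (hx1 : x < 1) (hs0 : 0 < s)
    (hs : s ^ 2 * (1 + x ^ 2 - 2 * x * Real.cos (Real.pi / n)) ≤ 1)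
    (hM : 0 < M) (hbM : 4 ≤ 27 * (1 - x ^ 2) * M ^ 2) (hbs : 1 ≤ 3 * (1 - x ^ 2) * s ^ 2)
    (hA : 2 * (s - (1 - x ^ 2) * s ^ 3) + (n - 2) * M < x ^ 2 * (n - 1) / 2)
    (hB : 2 * (n * (n - 1) / 11.3) * (1 + x + x ^ 2) <
      x * (1 + x) * (2 * ((1 + x ^ 2) * s ^ 3 - s) - (n - 2) / 3)) :
    numer n x ε < 0 := by
  have hn' : (4 : ℝ) ≤ n := by exact_mod_cast hn
  have hxpos : 0 < x := by linarith
  have hKle := mul_kn_le hn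
  have hleK := le_mul_kn (n := n) (by omega)
  set K : ℝ := n * kn n with hK
  set t : ℕ → ℝ := fun k => 1 / √(sqDist n k x) with ht
  have htpos : ∀ k ∈ Finset.Icc 1 n, 0 < t k := fun k hk =>
    one_div_pos.2 (Real.sqrt_pos.2 (sqDist_pos hk hxpos.le))
  have htsq : ∀ k ∈ Finset.Icc 1 n, t k ^ 2 * sqDist n k x = 1 := by
    intro k hk
    have hd := sqDist_pos hk hxpos.le
    simp only [ht]
    rw [div_pow, Real.sq_sqrt hd.le]
    field_simp
  have hst : ∀ k ∈ Finset.Icc 1 n, Real.cos (phi n k) = Real.cos (Real.pi / n) → s ≤ t k := by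
    intro k hk hc
    rw [← hc] at hs
    have hd := sqDist_pos hk hxpos.le
    have h1 : s ^ 2 * sqDist n k x ≤ t k ^ 2 * sqDist n k x := by rw [htsq k hk]; exact hs
    exact le_of_sq_le_sq (le_of_mul_le_mul_right h1 hd) (htpos k hk).le
  have hmem1 : 1 ∈ Finset.Icc 1 n := Finset.mem_Icc.2 ⟨le_rfl, by omega⟩
  have hmemn : n ∈ Finset.Icc 1 n := Finset.mem_Icc.2 ⟨by omega, le_rfl⟩
  have hst1 : s ≤ t 1 := hst 1 hmem1 (by rw [phi]; norm_num)
  have hstn : s ≤ t n := by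
    refine hst n hmemn ?_
    have e : phi n n = 2 * Real.pi - Real.pi / n := by
      rw [phi]
      field_simp
    rw [e, Real.cos_two_pi_sub]
  have hSA : ∑ k ∈ Finset.Icc 1 n, (t k - (1 - x ^ 2) * t k ^ 3) < 2 * x ^ 2 * K := by
    have h1 := sum_Icc_le_of_ends (n := n) (by omega) (f := fun k => t k - (1 - x ^ 2) * t k ^ 3)
      (sub_mul_cube_anti hs0.le hst1 hbs) (sub_mul_cube_anti hs0.le hstn hbs)
      fun k hk => sub_mul_cube_le (htpos k hk).le hM hbM
    nlinarith
  have hSB : ∑ k ∈ Finset.Icc 1 n, (t k - (1 + x ^ 2) * t k ^ 3) ≤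
      2 * (s - (1 + x ^ 2) * s ^ 3) + (n - 2) * (1 / 3) := by
    have hbs' : 1 ≤ 3 * (1 + x ^ 2) * s ^ 2 := by
      nlinarith [mul_pos (sq_pos_of_pos hxpos) (sq_pos_of_pos hs0)]
    exact sum_Icc_le_of_ends (n := n) (by omega) (f := fun k => t k - (1 + x ^ 2) * t k ^ 3)
      (sub_mul_cube_anti hs0.le hst1 hbs') (sub_mul_cube_anti hs0.le hstn hbs')
      fun k hk => sub_mul_cube_le (htpos k hk).le (by norm_num) (by nlinarith)
  have hterm : ∀ k ∈ Finset.Icc 1 n,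
      (x * (1 - ε) - (1 - ε * x ^ 2) * Real.cos (phi n k)) / sqDist n k x ^ ((3 : ℝ) / 2) =
        (1 - ε) / (2 * x) * (t k - (1 - x ^ 2) * t k ^ 3) +
          ε * (1 - x ^ 2) / (2 * x) * (t k - (1 + x ^ 2) * t k ^ 3) := by
    intro k hk
    have hd := sqDist_pos hk hxpos.le
    have e1 : 1 / sqDist n k x ^ ((3 : ℝ) / 2) = t k ^ 3 := by
      rw [rpow_three_halves hd]
      simp only [ht, div_pow, one_pow]
    have e2 : t k = t k ^ 3 * sqDist n k x := by
      linear_combination (-t k) * htsq k hk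
    have e3 : Real.cos (phi n k) = (1 + x ^ 2 - sqDist n k x) / (2 * x) := by
      rw [sqDist]
      field_simp
      ring
    rw [div_eq_mul_one_div, e1, e3]
    field_simp
    linear_combination (-(1 - ε) - ε * (1 - x ^ 2)) * e2
  rw [numer, Finset.sum_congr rfl hterm, Finset.sum_add_distrib, ← Finset.mul_sum,
    ← Finset.mul_sum]
  set P := ∑ k ∈ Finset.Icc 1 n, (t k - (1 - x ^ 2) * t k ^ 3)
  set Q := ∑ k ∈ Finset.Icc 1 n, (t k - (1 + x ^ 2) * t k ^ 3)
  have hQ : 2 * K * (1 + x + x ^ 2) + x * (1 + x) * Q < 0 := by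
    have h1 : x * (1 + x) * Q ≤
        x * (1 + x) * (2 * (s - (1 + x ^ 2) * s ^ 3) + (n - 2) * (1 / 3)) := by gcongr
    have h2 : 2 * K * (1 + x + x ^ 2) ≤ 2 * (n * (n - 1) / 11.3) * (1 + x + x ^ 2) := by gcongr
    linarith
  have e : K * (ε - x ^ 3) +
      x ^ 2 * ((1 - ε) / (2 * x) * P + ε * (1 - x ^ 2) / (2 * x) * Q) =
      -((1 - ε) * (x / 2) * (2 * x ^ 2 * K - P)) -
        ε * ((1 - x) / 2) * -(2 * K * (1 + x + x ^ 2) + x * (1 + x) * Q) := by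
    field_simp
    ring
  rw [e]
  have p1 : 0 < (1 - ε) * (x / 2) * (2 * x ^ 2 * K - P) :=
    mul_pos (mul_pos (sub_pos.2 hε.2) (by positivity)) (sub_pos.2 hSA)
  have p2 : 0 < ε * ((1 - x) / 2) * -(2 * K * (1 + x + x ^ 2) + x * (1 + x) * Q) :=
    mul_pos (mul_pos hε.1 (by linarith)) (neg_pos.2 hQ)
  linarith

lemma exists_numer_neg {n : ℕ} (hn : 4 ≤ n) {ε : ℝ} (hε : ε ∈ Set.Ioo (0 : ℝ) 1) :
    ∃ x ∈ Set.Ioo (0 : ℝ) 1, numer n x ε < 0 := by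
  rcases hn.eq_or_lt with rfl | hn5
  · have hs2 : (1.4142 : ℝ) ≤ √2 := Real.le_sqrt_of_sq_le (by norm_num)
    refine ⟨0.64, by norm_num, numer_neg_of_bounds (s := 1.4) (M := 0.502) le_rfl hε
      (by norm_num) (by norm_num) (by norm_num) ?_ (by norm_num) (by norm_num) (by norm_num)
      (by norm_num) (by norm_num)⟩
    rw [Nat.cast_ofNat, Real.cos_pi_div_four]
    nlinarith
  · have hn' : (5 : ℝ) ≤ n := by exact_mod_cast hn5
    obtain ⟨m, hm0, hm⟩ : ∃ m : ℝ, 0 ≤ m ∧ (n : ℝ) = m + 5 := ⟨n - 5, by linarith, by ring⟩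
    have hpos : 0 < m + 5 := by linarith
    have hx0 : 0.72 ≤ 1 - 1.4 / (m + 5) := by
      have : 1.4 / (m + 5) ≤ 0.28 := by
        rw [div_le_iff₀ hpos]
        linarith
      linarith
    have hx1 : 1 - 1.4 / (m + 5) < 1 := by
      have : 0 < 1.4 / (m + 5) := by positivity
      linarith
    refine ⟨1 - 1.4 / (m + 5), ⟨by linarith, hx1⟩,
      numer_neg_of_bounds (s := 0.29 * m + 1.62) (M := 0.0506 * m + 0.5566) hn hε
      (by linarith) hx1 (by positivity) ?_ (by positivity) ?_ ?_ ?_ ?_⟩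
    · rw [hm]
      have hc := Real.one_sub_sq_div_two_le_cos (x := Real.pi / (m + 5))
      have hpi : Real.pi ^ 2 ≤ 9.87 := by nlinarith [Real.pi_lt_d4, Real.pi_pos]
      have hc' : 1 - 9.87 / (m + 5) ^ 2 / 2 ≤ Real.cos (Real.pi / (m + 5)) := by
        refine le_trans ?_ hc
        rw [div_pow]
        gcongr
      set x := 1 - 1.4 / (m + 5) with hx
      calc _ ≤ (0.29 * m + 1.62) ^ 2 * (1 + x ^ 2 - 2 * x * (1 - 9.87 / (m + 5) ^ 2 / 2)) := by
            have : 0 < x := by linarith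
            gcongr
        _ ≤ 1 := by
            rw [hx, ← sub_nonneg]
            field_simp
            ring_nf
            positivity
    · rw [← sub_nonneg]
      field_simp
      ring_nf
      positivity
    · rw [← sub_nonneg]
      field_simp
      ring_nf
      positivity
    · rw [hm, ← sub_pos]
      field_simp
      ring_nf
      positivity
    · rw [hm, ← sub_pos]
      field_simp
      ring_nf
      positivity

/-- For `n > 3`, `ε ∈ (0,1)`, there exists `μ_n* > 0` such that for every
`0 < μ < μ_n*` the equation `h(x, ε) = μ` has at least two distinct solutions in `(0,1)`. -/
theorem two_cc_lt_one_for_small_mu (n : ℕ) (hn : 3 < n) (ε : ℝ)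
    (hε : ε ∈ Set.Ioo (0 : ℝ) 1) :
    ∃ muStar : ℝ, 0 < muStar ∧ ∀ μ : ℝ, 0 < μ → μ < muStar →
      ∃ x y : ℝ, x ∈ Set.Ioo (0 : ℝ) 1 ∧ y ∈ Set.Ioo (0 : ℝ) 1 ∧ x ≠ y ∧
        h n x ε = μ ∧ h n y ε = μ := by
  obtain ⟨z, hz, hneg⟩ := exists_numer_neg (n := n) hn hε
  have hcube : ∀ x ∈ Set.Ioo (0 : ℝ) 1, 0 < 1 - x ^ 3 := fun x hx =>
    sub_pos.2 (pow_lt_one₀ hx.1.le hx.2 (by norm_num))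
  refine ⟨h n z ε, ?_, fun μ hμ hlt => ?_⟩
  · rw [h_eq]
    exact div_pos (neg_pos.2 hneg) (hcube z hz)
  set F : ℝ → ℝ := fun x => numer n x ε + μ * (1 - x ^ 3) with hF
  have hcont : ContinuousOn F (Set.Ici 0) := (continuousOn_numer n ε).add (by fun_prop)
  have hF0 : 0 < F 0 := by
    have := numer_zero_pos (n := n) (by omega) hε.1
    simp only [hF]
    norm_num
    linarith
  have hF1 : 0 < F 1 := by
    have := numer_one_pos (n := n) (by omega) hε.2
    simp only [hF]
    norm_num
    linarith
  have hFz : F z < 0 := by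
    rw [h_eq, lt_div_iff₀ (hcube z hz)] at hlt
    simp only [hF]
    linarith
  have hroot : ∀ x ∈ Set.Ioo (0 : ℝ) 1, F x = 0 → h n x ε = μ := by
    intro x hx h0
    rw [h_eq, div_eq_iff (hcube x hx).ne']
    simp only [hF] at h0
    linarith
  obtain ⟨x, hx, hFx⟩ := intermediate_value_Ioo' hz.1.le
    (hcont.mono fun y hy => hy.1) (⟨hFz, hF0⟩ : (0 : ℝ) ∈ Set.Ioo (F z) (F 0))
  obtain ⟨y, hy, hFy⟩ := intermediate_value_Ioo hz.2.le
    (hcont.mono fun y hy => hz.1.le.trans hy.1) (⟨hFz, hF1⟩ : (0 : ℝ) ∈ Set.Ioo (F z) (F 1))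
  have hx' : x ∈ Set.Ioo (0 : ℝ) 1 := ⟨hx.1, hx.2.trans hz.2⟩
  have hy' : y ∈ Set.Ioo (0 : ℝ) 1 := ⟨hz.1.trans hy.1, hy.2⟩
  exact ⟨x, y, hx', hy', (hx.2.trans hy.1).ne, hroot x hx' hFx, hroot y hy' hFy⟩
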